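/- Let q be a conservative Q-function satisfying Assumption L1. Then for all t ∈ (T₀,T₁), x ∈ X, and B ∈ 𝓑(X): (i) lim_{u→t−} P̄(u,x;t,B) = 1{x∈B} and the function u ↦ P̄(u,x;t,B) is absolutely continuous on [T₀,t); (ii) Kolmogorov's backward equation (∂/∂u)P̄(u,x;t,B) = q(x,u)·P̄(u,x;t,B) − ∫_X P̄(u,y;t,B) q(x,u,dy∖{x}) holds at almost every u ∈ [T₀,t). -/

import Mathlib

open MeasureTheory Set Filter Topology
open scoped ENNReal

noncomputable section

/-- A conservative `Q`-function on the state space `X` with time horizon `[T₀, T₁)`,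
`T₁ ≤ +∞`.  It is encoded by the kernel `qp x t = q(x, t, · \ {x})`; since `q` is
conservative, the signed measure `q(x,t,·)` is recovered as
`q(x,t,B) = qp x t B - qp x t univ · 1{x ∈ B}`, so that `q(x,t,X) = 0`. -/
structure ConsQFun (X : Type*) [MeasurableSpace X] (T₀ : ℝ) (T₁ : EReal) where
  qp : X → ℝ → Measure X
  fin : ∀ x t, qp x t Set.univ ≠ ⊤
  diag : ∀ x t, qp x t {x} = 0
  meas : ∀ B : Set X, MeasurableSet B → Measurable fun p : X × ℝ => qp p.1 p.2 B

namespace ConsQFun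

variable {X : Type*} [MeasurableSpace X] {T₀ : ℝ} {T₁ : EReal}

/-- The jump rate `q(x,t) = q(x, t, X \ {x})`, as a real number. -/
def qrate (Q : ConsQFun X T₀ T₁) (x : X) (t : ℝ) : ℝ := (Q.qp x t Set.univ).toReal

/-- `q̄(x) = sup_{t ∈ [T₀,T₁)} q(x,t)`, computed in `ℝ≥0∞`. -/
def qbar (Q : ConsQFun X T₀ T₁) (x : X) : ℝ≥0∞ :=
  ⨆ t ∈ {t : ℝ | T₀ ≤ t ∧ (t : EReal) < T₁}, Q.qp x t Set.univ

/-- Assumption (Feller): there are Borel sets `Bₙ ↑ X` with `sup_{x ∈ Bₙ} q̄(x) < n`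
(for `n = 1, 2, …`; here reindexed by `n ↦ n + 1`). -/
def AssumptionFeller (Q : ConsQFun X T₀ T₁) : Prop :=
  ∃ B : ℕ → Set X, (∀ n, MeasurableSet (B n)) ∧ (∀ n, B n ⊆ B (n + 1)) ∧
    (⋃ n, B n) = Set.univ ∧ ∀ n : ℕ, (⨆ x ∈ B n, Q.qbar x) < (n : ℝ≥0∞) + 1

/-- Assumption (LB): `q̄(x) < ∞` for every `x`. -/
def AssumptionLB (Q : ConsQFun X T₀ T₁) : Prop := ∀ x, Q.qbar x < ⊤

/-- Assumption (ALB): `sup_{t ∈ [T₀,s)} q(x,t) < ∞` for every `x` and `s ∈ (T₀,T₁)`. -/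
def AssumptionALB (Q : ConsQFun X T₀ T₁) : Prop :=
  ∀ (x : X) (s : ℝ), T₀ < s → (s : EReal) < T₁ →
    (⨆ t ∈ Set.Ico T₀ s, Q.qp x t Set.univ) < ⊤

/-- Assumption (L1): `∫_{T₀}^s q(x,t) dt < ∞` for every `x` and `s ∈ (T₀,T₁)`. -/
def AssumptionL1 (Q : ConsQFun X T₀ T₁) : Prop :=
  ∀ (x : X) (s : ℝ), T₀ < s → (s : EReal) < T₁ →
    ∫⁻ t in Set.Ico T₀ s, Q.qp x t Set.univ < ⊤

/-- A set `B` is `(q,s)`-bounded if `q(x,t)` is bounded on `B × [T₀, s)`; for `s = T₁`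
this is the notion of a `q`-bounded set. -/
def QBddOn (Q : ConsQFun X T₀ T₁) (s : EReal) (B : Set X) : Prop :=
  ∃ C : ℝ≥0∞, C ≠ ⊤ ∧ ∀ x ∈ B, ∀ t : ℝ, T₀ ≤ t → (t : EReal) < s → Q.qp x t Set.univ ≤ C

/-- Feller's iterates: `P̄⁽⁰⁾(u,x;t,B) = 1{x∈B} e^{-∫_u^t q(x,s) ds}` and
`P̄⁽ⁿ⁾(u,x;t,B) = ∫_u^t ∫_X e^{-∫_u^w q(x,θ) dθ} P̄⁽ⁿ⁻¹⁾(w,y;t,B) q(x,w,dy∖{x}) dw`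
(the measure `q(x,w, ·∖{x})` is `Q.qp x w`, which has no atom at `x`). -/
def PbarN (Q : ConsQFun X T₀ T₁) : ℕ → ℝ → X → ℝ → Set X → ℝ≥0∞
  | 0 => fun u x t B =>
      B.indicator (fun _ => ENNReal.ofReal (Real.exp (-(∫ s in u..t, Q.qrate x s)))) x
  | n + 1 => fun u x t B =>
      ∫⁻ w in Set.Ioo u t,
        ∫⁻ y, ENNReal.ofReal (Real.exp (-(∫ θ in u..w, Q.qrate x θ))) * Q.PbarN n w y t B
          ∂(Q.qp x w)

/-- The transition function `P̄(u,x;t,B) = Σ_{n=0}^∞ P̄⁽ⁿ⁾(u,x;t,B)`. -/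
def Pbar (Q : ConsQFun X T₀ T₁) (u : ℝ) (x : X) (t : ℝ) (B : Set X) : ℝ≥0∞ :=
  ∑' n, Q.PbarN n u x t B

/-- `P̄` as a real-valued function. -/
def PbarR (Q : ConsQFun X T₀ T₁) (u : ℝ) (x : X) (t : ℝ) (B : Set X) : ℝ :=
  (Q.Pbar u x t B).toReal

end ConsQFun

/-- A real-valued function `f` is absolutely continuous on a set `s ⊆ ℝ`: for every `ε > 0`
there is `δ > 0` such that for every finite collection of nonoverlapping intervals
`(aᵢ, bᵢ)` with endpoints in `s` and total length `< δ`, `Σ |f(bᵢ) - f(aᵢ)| < ε`. -/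
def AbsContinuousOn (f : ℝ → ℝ) (s : Set ℝ) : Prop :=
  ∀ ε > (0 : ℝ), ∃ δ > (0 : ℝ), ∀ (n : ℕ) (a b : ℕ → ℝ),
    (∀ i, i < n → a i ∈ s ∧ b i ∈ s ∧ a i ≤ b i) →
    (∀ i, i < n → ∀ j, j < n → i ≠ j → Disjoint (Set.Ioo (a i) (b i)) (Set.Ioo (a j) (b j))) →
    (∑ i ∈ Finset.range n, (b i - a i)) < δ →
    (∑ i ∈ Finset.range n, |f (b i) - f (a i)|) < ε

namespace ConsQFun

variable {X : Type*} [MeasurableSpace X] {T₀ : ℝ} {T₁ : EReal}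

lemma aux_isFin (Q : ConsQFun X T₀ T₁) (x : X) (t : ℝ) : IsFiniteMeasure (Q.qp x t) :=
  ⟨(Q.fin x t).lt_top⟩

lemma aux_meas_qrate (Q : ConsQFun X T₀ T₁) : Measurable fun p : X × ℝ => Q.qrate p.1 p.2 :=
  (Q.meas _ MeasurableSet.univ).ennreal_toReal

lemma aux_meas_int (Q : ConsQFun X T₀ T₁) :
    Measurable fun p : X × ℝ × ℝ => ∫ s in p.2.1..p.2.2, Q.qrate p.1 s := by
  have key : ∀ a b : X × ℝ × ℝ → ℝ, Measurable a → Measurable b →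
      Measurable fun p : X × ℝ × ℝ => ∫ s in Set.Ioc (a p) (b p), Q.qrate p.1 s := by
    intro a b ha hb
    have h1 : ∀ p : X × ℝ × ℝ, ∫ s in Set.Ioc (a p) (b p), Q.qrate p.1 s
        = ∫ s, {r : (X × ℝ × ℝ) × ℝ | a r.1 < r.2 ∧ r.2 ≤ b r.1}.indicator
            (fun r => Q.qrate r.1.1 r.2) (p, s) := by
      intro p
      rw [← integral_indicator measurableSet_Ioc]
      rfl
    simp_rw [h1]
    refine (StronglyMeasurable.integral_prod_right' (Measurable.stronglyMeasurable ?_)).measurable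
    refine Measurable.indicator ?_ ?_
    · exact Q.aux_meas_qrate.comp (by fun_prop : Measurable fun r : (X × ℝ × ℝ) × ℝ => (r.1.1, r.2))
    · exact (measurableSet_lt (ha.comp measurable_fst) measurable_snd).inter
        (measurableSet_le measurable_snd (hb.comp measurable_fst))
  unfold intervalIntegral
  exact (key _ _ (by fun_prop) (by fun_prop)).sub (key _ _ (by fun_prop) (by fun_prop))

lemma aux_meas_inner (Q : ConsQFun X T₀ T₁) {F : ℝ × X → ℝ≥0∞} (hF : Measurable F) :
    Measurable fun p : X × ℝ => ∫⁻ y, F (p.2, y) ∂(Q.qp p.1 p.2) := by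
  have hfin : ∀ p : X × ℝ, IsFiniteMeasure (Q.qp p.1 p.2) := fun p => Q.aux_isFin _ _
  have h1 : ∀ p : X × ℝ, ∫⁻ y, F (p.2, y) ∂(Q.qp p.1 p.2)
      = ∫⁻ z, F z ∂((Q.qp p.1 p.2).map (fun y => (p.2, y))) := by
    intro p
    rw [lintegral_map hF (by fun_prop)]
  simp_rw [h1]
  refine (Measure.measurable_lintegral hF).comp ?_
  refine Measurable.measure_of_isPiSystem generateFrom_prod.symm isPiSystem_prod ?_ ?_
  · rintro _ ⟨s, hs, v, hv, rfl⟩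
    replace hs : MeasurableSet s := hs
    replace hv : MeasurableSet v := hv
    have h2 : ∀ p : X × ℝ, ((Q.qp p.1 p.2).map (fun y => (p.2, y))) (s ×ˢ v)
        = (Prod.snd ⁻¹' s : Set (X × ℝ)).indicator (fun p => Q.qp p.1 p.2 v) p := by
      intro p
      rw [Measure.map_apply (by fun_prop) (MeasurableSet.prod hs hv)]
      by_cases hp : p.2 ∈ s
      · rw [indicator_of_mem (by exact hp)]
        congr 1
        ext y
        simp [hp]
      · rw [indicator_of_notMem (by exact hp)]
        convert measure_empty (μ := Q.qp p.1 p.2)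
        ext y
        simp [hp]
    simp_rw [h2]
    exact (Q.meas v hv).indicator (measurable_snd hs)
  · have h2 : ∀ p : X × ℝ, ((Q.qp p.1 p.2).map (fun y => (p.2, y))) univ
        = Q.qp p.1 p.2 univ := by
      intro p
      rw [Measure.map_apply (by fun_prop) MeasurableSet.univ, preimage_univ]
    simp_rw [h2]
    exact Q.meas _ MeasurableSet.univ

lemma aux_meas_PbarN (Q : ConsQFun X T₀ T₁) (t : ℝ) {B : Set X} (hB : MeasurableSet B) (n : ℕ) :
    Measurable fun p : ℝ × X => Q.PbarN n p.1 p.2 t B := by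
  induction n with
  | zero =>
    have : (fun p : ℝ × X => Q.PbarN 0 p.1 p.2 t B) = (Prod.snd ⁻¹' B : Set (ℝ × X)).indicator
        (fun p => ENNReal.ofReal (Real.exp (-(∫ s in p.1..t, Q.qrate p.2 s)))) := by
      ext p
      simp only [PbarN]
      rfl
    rw [this]
    refine Measurable.indicator ?_ (measurable_snd hB)
    have := Q.aux_meas_int.comp (by fun_prop : Measurable fun p : ℝ × X => (p.2, p.1, t))
    exact (Real.measurable_exp.comp this.neg).ennreal_ofReal
  | succ n ih =>
    have h1 : ∀ p : ℝ × X, Q.PbarN (n+1) p.1 p.2 t B =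
        ∫⁻ w, {r : (ℝ × X) × ℝ | r.1.1 < r.2 ∧ r.2 < t}.indicator (fun r =>
          ENNReal.ofReal (Real.exp (-(∫ θ in r.1.1..r.2, Q.qrate r.1.2 θ))) *
          ∫⁻ y, Q.PbarN n r.2 y t B ∂(Q.qp r.1.2 r.2)) (p, w) := by
      intro p
      simp only [PbarN]
      rw [← lintegral_indicator measurableSet_Ioo]
      refine lintegral_congr fun w => ?_
      by_cases hw : w ∈ Set.Ioo p.1 t
      · rw [indicator_of_mem hw, indicator_of_mem (by exact hw), lintegral_const_mul]
        exact ih.comp (by fun_prop : Measurable fun y : X => (w, y))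
      · rw [indicator_of_notMem hw, indicator_of_notMem (by exact hw)]
    simp_rw [h1]
    refine Measurable.lintegral_prod_right' (Measurable.indicator (Measurable.mul ?_ ?_) ?_)
    · have := Q.aux_meas_int.comp
        (by fun_prop : Measurable fun r : (ℝ × X) × ℝ => (r.1.2, r.1.1, r.2))
      exact (Real.measurable_exp.comp this.neg).ennreal_ofReal
    · exact (Q.aux_meas_inner ih).comp
        (by fun_prop : Measurable fun r : (ℝ × X) × ℝ => (r.1.2, r.2))
    · exact (measurableSet_lt (measurable_fst.comp measurable_fst) measurable_snd).inter
        (measurableSet_lt measurable_snd measurable_const)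

lemma aux_meas_Pbar (Q : ConsQFun X T₀ T₁) (t : ℝ) {B : Set X} (hB : MeasurableSet B) :
    Measurable fun p : ℝ × X => Q.Pbar p.1 p.2 t B :=
  Measurable.tsum fun n => Q.aux_meas_PbarN t hB n

lemma aux_PbarN_succ (Q : ConsQFun X T₀ T₁) (t : ℝ) {B : Set X} (hB : MeasurableSet B) (n : ℕ)
    (u : ℝ) (x : X) : Q.PbarN (n+1) u x t B =
      ∫⁻ w in Set.Ioo u t, ENNReal.ofReal (Real.exp (-(∫ θ in u..w, Q.qrate x θ))) *
          ∫⁻ y, Q.PbarN n w y t B ∂(Q.qp x w) := by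
  simp only [PbarN]
  refine lintegral_congr fun w => ?_
  rw [lintegral_const_mul]
  exact (Q.aux_meas_PbarN t hB n).comp (by fun_prop : Measurable fun y : X => (w, y))

lemma aux_meas_integrand (Q : ConsQFun X T₀ T₁) {F : ℝ × X → ℝ≥0∞} (hF : Measurable F)
    (u : ℝ) (x : X) : Measurable fun w : ℝ =>
      ENNReal.ofReal (Real.exp (-(∫ θ in u..w, Q.qrate x θ))) * ∫⁻ y, F (w, y) ∂(Q.qp x w) := by
  refine Measurable.mul ?_ ?_
  · have := Q.aux_meas_int.comp (by fun_prop : Measurable fun w : ℝ => (x, u, w))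
    exact (Real.measurable_exp.comp this.neg).ennreal_ofReal
  · exact (Q.aux_meas_inner hF).comp (by fun_prop : Measurable fun w : ℝ => (x, w))

lemma aux_Pbar_eq (Q : ConsQFun X T₀ T₁) (t : ℝ) {B : Set X} (hB : MeasurableSet B)
    (u : ℝ) (x : X) : Q.Pbar u x t B = Q.PbarN 0 u x t B +
      ∫⁻ w in Set.Ioo u t, ENNReal.ofReal (Real.exp (-(∫ θ in u..w, Q.qrate x θ))) *
          ∫⁻ y, Q.Pbar w y t B ∂(Q.qp x w) := by
  rw [Pbar, tsum_eq_zero_add' ENNReal.summable]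
  congr 1
  simp_rw [Q.aux_PbarN_succ t hB]
  rw [← lintegral_tsum
    (fun n => (Q.aux_meas_integrand (Q.aux_meas_PbarN t hB n) u x).aemeasurable)]
  refine lintegral_congr fun w => ?_
  rw [ENNReal.tsum_mul_left, ← lintegral_tsum]
  · rfl
  · intro n
    exact ((Q.aux_meas_PbarN t hB n).comp
      (by fun_prop : Measurable fun y : X => (w, y))).aemeasurable

lemma aux_sum_eq (Q : ConsQFun X T₀ T₁) (t : ℝ) {B : Set X} (hB : MeasurableSet B)
    (u : ℝ) (x : X) (n : ℕ) :
    ∑ k ∈ Finset.range (n+1), Q.PbarN k u x t B = Q.PbarN 0 u x t B +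
      ∫⁻ w in Set.Ioo u t, ENNReal.ofReal (Real.exp (-(∫ θ in u..w, Q.qrate x θ))) *
          ∫⁻ y, ∑ k ∈ Finset.range n, Q.PbarN k w y t B ∂(Q.qp x w) := by
  rw [Finset.sum_range_succ', add_comm]
  congr 1
  simp_rw [Q.aux_PbarN_succ t hB]
  rw [← lintegral_finsetSum _
    (fun n _ => (Q.aux_meas_integrand (Q.aux_meas_PbarN t hB n) u x))]
  refine lintegral_congr fun w => ?_
  rw [← Finset.mul_sum, ← lintegral_finsetSum]
  intro n _
  exact ((Q.aux_meas_PbarN t hB n).comp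
      (by fun_prop : Measurable fun y : X => (w, y)))

lemma aux_integrableOn (Q : ConsQFun X T₀ T₁) (hL1 : Q.AssumptionL1) {t : ℝ}
    (ht₀ : T₀ < t) (ht₁ : (t : EReal) < T₁) (x : X) :
    IntervalIntegrable (Q.qrate x) volume T₀ t := by
  rw [intervalIntegrable_iff_integrableOn_Ico_of_le ht₀.le]
  refine integrable_toReal_of_lintegral_ne_top ?_ (hL1 x t ht₀ ht₁).ne
  exact ((Q.meas _ MeasurableSet.univ).comp
    (by fun_prop : Measurable fun w : ℝ => (x, w))).aemeasurable

lemma aux_ac_exp {f : ℝ → ℝ} {a b : ℝ} (hf : AbsolutelyContinuousOnInterval f a b) :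
    AbsolutelyContinuousOnInterval (fun u => Real.exp (f u)) a b := by
  obtain ⟨C, hC⟩ := hf.exists_bound
  have hlip : ∀ y z : ℝ, y ≤ C → z ≤ C →
      dist (Real.exp y) (Real.exp z) ≤ Real.exp C * dist y z := by
    have h0 : ∀ y z : ℝ, y ≤ C → z ≤ y → Real.exp y - Real.exp z ≤ Real.exp C * (y - z) := by
      intro y z hy hz
      have h1 := Real.add_one_le_exp (z - y)
      have h2 : Real.exp z = Real.exp y * Real.exp (z - y) := by
        rw [← Real.exp_add]; ring_nf
      have h3 : Real.exp y ≤ Real.exp C := Real.exp_le_exp.2 hy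
      have h4 := Real.exp_pos y
      rw [h2]
      nlinarith
    intro y z hy hz
    rw [Real.dist_eq, Real.dist_eq]
    rcases le_total z y with h | h
    · rw [abs_of_nonneg (by linarith [Real.exp_le_exp.2 h]), abs_of_nonneg (by linarith)]
      exact h0 y z hy h
    · rw [abs_sub_comm, abs_sub_comm y z, abs_of_nonneg (by linarith [Real.exp_le_exp.2 h]),
        abs_of_nonneg (by linarith)]
      exact h0 z y hz h
  rw [absolutelyContinuousOnInterval_iff] at hf ⊢
  intro ε hε
  obtain ⟨δ, hδ, h⟩ := hf (ε / Real.exp C) (by positivity)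
  refine ⟨δ, hδ, fun E hE hE2 => ?_⟩
  have h1 := h E hE hE2
  rw [lt_div_iff₀ (Real.exp_pos C), mul_comm, Finset.mul_sum] at h1
  refine lt_of_le_of_lt (Finset.sum_le_sum fun i hi => ?_) h1
  exact hlip _ _ ((le_abs_self _).trans (hC _ (hE.1 i hi).1))
    ((le_abs_self _).trans (hC _ (hE.1 i hi).2))

lemma aux_expint {q : ℝ → ℝ} (hq0 : ∀ w, 0 ≤ q w) {u t : ℝ} (hut : u ≤ t)
    (hq : IntervalIntegrable q volume u t) :
    ENNReal.ofReal (Real.exp (-(∫ s in u..t, q s))) +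
      ∫⁻ w in Set.Ioo u t, ENNReal.ofReal (Real.exp (-(∫ θ in u..w, q θ))) *
        ENNReal.ofReal (q w) = 1 := by
  have hA : AbsolutelyContinuousOnInterval (fun w => -(∫ θ in u..w, q θ)) u t :=
    (hq.absolutelyContinuousOnInterval_intervalIntegral left_mem_uIcc).fun_neg
  have hE := aux_ac_exp hA
  have h1 := hE.integral_deriv_eq_sub
  have h2 : ∫ w in u..t, deriv (fun w => Real.exp (-(∫ θ in u..w, q θ))) w
      = ∫ w in u..t, -(Real.exp (-(∫ θ in u..w, q θ)) * q w) := by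
    refine intervalIntegral.integral_congr_ae ?_
    filter_upwards [hq.ae_hasDerivAt_integral] with w hw hw2
    have := (hw (uIoc_subset_uIcc hw2) u left_mem_uIcc).fun_neg.exp.deriv
    rw [this]; ring
  rw [h2, intervalIntegral.integral_neg] at h1
  have hint : IntervalIntegrable (fun w => Real.exp (-(∫ θ in u..w, q θ)) * q w) volume u t :=
    hq.continuousOn_mul hE.continuousOn
  simp_rw [← ENNReal.ofReal_mul (Real.exp_pos _).le]
  rw [← ofReal_integral_eq_lintegral_ofReal]
  · rw [← integral_Ioc_eq_integral_Ioo, ← intervalIntegral.integral_of_le hut,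
      ← ENNReal.ofReal_add (Real.exp_pos _).le]
    · simp only [intervalIntegral.integral_same, neg_zero, Real.exp_zero] at h1
      rw [show Real.exp (-(∫ s in u..t, q s)) +
        ∫ w in u..t, Real.exp (-(∫ θ in u..w, q θ)) * q w = 1 by linarith]
      simp
    · exact intervalIntegral.integral_nonneg_of_forall hut
        fun w => mul_nonneg (Real.exp_pos _).le (hq0 w)
  · exact ((intervalIntegrable_iff_integrableOn_Ioo_of_le hut).1 hint)
  · exact Eventually.of_forall fun w => mul_nonneg (Real.exp_pos _).le (hq0 w)

lemma aux_le_one (Q : ConsQFun X T₀ T₁) (hL1 : Q.AssumptionL1) {t : ℝ}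
    (ht₀ : T₀ < t) (ht₁ : (t : EReal) < T₁) {B : Set X} (hB : MeasurableSet B)
    {u : ℝ} (hu : T₀ ≤ u) (hut : u ≤ t) (x : X) : Q.Pbar u x t B ≤ 1 := by
  have key : ∀ n : ℕ, ∀ u, T₀ ≤ u → u ≤ t → ∀ x,
      ∑ k ∈ Finset.range n, Q.PbarN k u x t B ≤ 1 := by
    intro n
    induction n with
    | zero => simp
    | succ n ih =>
      intro u hu hut x
      rw [Q.aux_sum_eq t hB u x n]
      have hq : IntervalIntegrable (Q.qrate x) volume u t :=
        (Q.aux_integrableOn hL1 ht₀ ht₁ x).mono_set (by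
          rw [uIcc_of_le hut, uIcc_of_le ht₀.le]; exact Icc_subset_Icc_left hu)
      rw [← aux_expint (q := Q.qrate x) (fun w => ENNReal.toReal_nonneg) hut hq]
      refine add_le_add ?_ ?_
      · simp only [PbarN]
        exact indicator_le_self' (fun _ _ => zero_le) x
      · refine setLIntegral_mono' measurableSet_Ioo fun w hw => ?_
        refine mul_le_mul_right ?_ _
        calc ∫⁻ y, ∑ k ∈ Finset.range n, Q.PbarN k w y t B ∂(Q.qp x w)
            ≤ ∫⁻ y, 1 ∂(Q.qp x w) :=
              lintegral_mono fun y => ih w (hu.trans hw.1.le) hw.2.le y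
          _ = ENNReal.ofReal (Q.qrate x w) := by
              rw [lintegral_one, qrate, ENNReal.ofReal_toReal (Q.fin x w)]
  rw [Pbar, ENNReal.tsum_eq_iSup_nat]
  exact iSup_le fun n => key n u hu hut x

end ConsQFun

lemma aux_absCont {f : ℝ → ℝ} {a b : ℝ} (hab : a ≤ b)
    (hf : AbsolutelyContinuousOnInterval f a b) : AbsContinuousOn f (Set.Ico a b) := by
  rw [absolutelyContinuousOnInterval_iff] at hf
  intro ε hε
  obtain ⟨δ, hδ, h⟩ := hf ε hε
  refine ⟨δ, hδ, fun n c d h1 h2 h3 => ?_⟩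
  have := h (n, fun i => (c i, d i)) ?_ ?_
  · simpa [Real.dist_eq, abs_sub_comm] using this
  · refine ⟨fun i hi => ?_, fun i hi j hj hij => ?_⟩
    · rw [uIcc_of_le hab]
      have := h1 i (Finset.mem_range.1 hi)
      exact ⟨Ico_subset_Icc_self this.1, Ico_subset_Icc_self this.2.1⟩
    · have hi' := Finset.mem_range.1 (Finset.mem_coe.1 hi)
      have hj' := Finset.mem_range.1 (Finset.mem_coe.1 hj)
      have h4 := h2 i hi' j hj' hij
      show Disjoint (uIoc (c i) (d i)) (uIoc (c j) (d j))
      rw [uIoc_of_le (h1 i hi').2.2, uIoc_of_le (h1 j hj').2.2, Ioc_disjoint_Ioc]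
      rwa [Ioo_disjoint_Ioo] at h4
  · refine lt_of_eq_of_lt (Finset.sum_congr rfl fun i hi => ?_) h3
    have := (h1 i (Finset.mem_range.1 hi)).2.2
    rw [dist_comm, Real.dist_eq]
    exact abs_of_nonneg (by linarith)

/-- under Assumption L1, for all `t ∈ (T₀,T₁)`, `x ∈ X` and Borel `B`:
(i) `P̄(u,x;t,B) → 1{x∈B}` as `u → t-` and `u ↦ P̄(u,x;t,B)` is absolutely continuous on
`[T₀,t)`; (ii) Kolmogorov's backward equation
`(∂/∂u)P̄(u,x;t,B) = q(x,u)P̄(u,x;t,B) − ∫_X P̄(u,y;t,B) q(x,u,dy∖{x})`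
holds at almost every `u ∈ [T₀,t)`. -/
theorem pbar_satisfies_backward_equation
    {X : Type*} [MeasurableSpace X] [StandardBorelSpace X]
    {T₀ : ℝ} {T₁ : EReal} (hT : (T₀ : EReal) < T₁)
    (Q : ConsQFun X T₀ T₁) (hL1 : Q.AssumptionL1)
    (t : ℝ) (x : X) (B : Set X)
    (ht₀ : T₀ < t) (ht₁ : (t : EReal) < T₁) (hB : MeasurableSet B) :
    (Filter.Tendsto (fun u => Q.PbarR u x t B) (𝓝[<] t)
        (𝓝 (B.indicator (fun _ => (1 : ℝ)) x)) ∧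
      AbsContinuousOn (fun u => Q.PbarR u x t B) (Set.Ico T₀ t)) ∧
    (∀ᵐ u ∂(volume.restrict (Set.Ico T₀ t)),
      HasDerivAt (fun v => Q.PbarR v x t B)
        (Q.qrate x u * Q.PbarR u x t B - ∫ y, Q.PbarR u y t B ∂(Q.qp x u)) u) := by
  classical
  set g : ℝ → ℝ := fun w => (∫⁻ y, Q.Pbar w y t B ∂(Q.qp x w)).toReal with hg
  set A : ℝ → ℝ := fun u => ∫ s in T₀..u, Q.qrate x s with hA
  set h : ℝ → ℝ := fun w => Real.exp (-(A w)) * g w with hh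
  set G : ℝ → ℝ := fun u => ∫ s in T₀..u, h s with hG
  set c : ℝ := B.indicator (fun _ => (1 : ℝ)) x * Real.exp (-(A t)) with hc
  have hq := Q.aux_integrableOn hL1 ht₀ ht₁ x
  have hsub : ∀ {a b : ℝ}, a ∈ Set.Icc T₀ t → b ∈ Set.Icc T₀ t → uIcc a b ⊆ uIcc T₀ t := by
    intro a b ha hb
    rw [uIcc_of_le ht₀.le]
    exact uIcc_subset_Icc ha hb
  have hgle : ∀ w ∈ Set.Icc T₀ t,
      ∫⁻ y, Q.Pbar w y t B ∂(Q.qp x w) ≤ Q.qp x w Set.univ := by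
    intro w hw
    calc ∫⁻ y, Q.Pbar w y t B ∂(Q.qp x w) ≤ ∫⁻ y, 1 ∂(Q.qp x w) :=
          lintegral_mono fun y => Q.aux_le_one hL1 ht₀ ht₁ hB hw.1 hw.2 y
      _ = _ := lintegral_one
  have hgfin : ∀ w ∈ Set.Icc T₀ t, ∫⁻ y, Q.Pbar w y t B ∂(Q.qp x w) ≠ ⊤ := fun w hw =>
    ((hgle w hw).trans_lt (Q.fin x w).lt_top).ne
  have hgmeas : Measurable g := ((Q.aux_meas_inner (Q.aux_meas_Pbar t hB)).comp
    (by fun_prop : Measurable fun w : ℝ => (x, w))).ennreal_toReal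
  have hgint : IntervalIntegrable g volume T₀ t := by
    rw [intervalIntegrable_iff_integrableOn_Icc_of_le ht₀.le] at hq ⊢
    refine Integrable.mono' hq hgmeas.aestronglyMeasurable ?_
    refine (ae_restrict_mem measurableSet_Icc).mono fun w hw => ?_
    rw [Real.norm_of_nonneg ENNReal.toReal_nonneg]
    exact ENNReal.toReal_mono (Q.fin x w) (hgle w hw)
  have hAac : AbsolutelyContinuousOnInterval A T₀ t :=
    hq.absolutelyContinuousOnInterval_intervalIntegral left_mem_uIcc
  have hhint : IntervalIntegrable h volume T₀ t :=
    hgint.continuousOn_mul (ConsQFun.aux_ac_exp hAac.fun_neg).continuousOn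
  have hGac : AbsolutelyContinuousOnInterval G T₀ t :=
    hhint.absolutelyContinuousOnInterval_intervalIntegral left_mem_uIcc
  have hAsub : ∀ u ∈ Set.Icc T₀ t, ∀ w ∈ Set.Icc T₀ t,
      ∫ s in u..w, Q.qrate x s = A w - A u := by
    intro u hu w hw
    have hT : T₀ ∈ Set.Icc T₀ t := left_mem_Icc.2 ht₀.le
    rw [hA]
    exact (intervalIntegral.integral_interval_sub_left
      (hq.mono_set (hsub hT hw)) (hq.mono_set (hsub hT hu))).symm
  set F : ℝ → ℝ := fun u => Real.exp (A u) * (c + (G t - G u)) with hF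
  have hform : ∀ u ∈ Set.Icc T₀ t, Q.PbarR u x t B = F u := by
    intro u hu
    have htm : t ∈ Set.Icc T₀ t := right_mem_Icc.2 ht₀.le
    have hT : T₀ ∈ Set.Icc T₀ t := left_mem_Icc.2 ht₀.le
    have e0 : Q.PbarN 0 u x t B = ENNReal.ofReal (Real.exp (A u) * c) := by
      simp only [ConsQFun.PbarN]
      rw [hAsub u hu t htm, hc]
      by_cases hx : x ∈ B
      · simp only [indicator_of_mem hx]
        rw [one_mul, ← Real.exp_add]
        ring_nf
      · simp [indicator_of_notMem hx]
    have hhu : IntervalIntegrable h volume u t := hhint.mono_set (hsub hu htm)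
    have hnn : ∀ w, 0 ≤ Real.exp (A u) * h w := fun w =>
      mul_nonneg (Real.exp_pos _).le (mul_nonneg (Real.exp_pos _).le ENNReal.toReal_nonneg)
    have e1 : ∫⁻ w in Set.Ioo u t, ENNReal.ofReal (Real.exp (-(∫ θ in u..w, Q.qrate x θ))) *
          ∫⁻ y, Q.Pbar w y t B ∂(Q.qp x w) = ENNReal.ofReal (Real.exp (A u) * (G t - G u)) := by
      have e2 : G t - G u = ∫ w in u..t, h w :=
        intervalIntegral.integral_interval_sub_left
          (hhint.mono_set (hsub hT htm)) (hhint.mono_set (hsub hT hu))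
      rw [e2, ← intervalIntegral.integral_const_mul, intervalIntegral.integral_of_le hu.2,
        integral_Ioc_eq_integral_Ioo, ofReal_integral_eq_lintegral_ofReal]
      · refine setLIntegral_congr_fun measurableSet_Ioo fun w hw => ?_
        have hw' : w ∈ Set.Icc T₀ t := ⟨hu.1.trans hw.1.le, hw.2.le⟩
        rw [hAsub u hu w hw', ← ENNReal.ofReal_toReal (hgfin w hw'),
          ← ENNReal.ofReal_mul (Real.exp_pos _).le, hh]
        simp only
        rw [← mul_assoc, ← Real.exp_add]
        ring_nf
        rfl
      · exact (intervalIntegrable_iff_integrableOn_Ioo_of_le hu.2).1 (hhu.const_mul _)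
      · exact Eventually.of_forall hnn
    have hGn : 0 ≤ G t - G u := by
      rw [show G t - G u = ∫ w in u..t, h w from
        intervalIntegral.integral_interval_sub_left
          (hhint.mono_set (hsub hT htm)) (hhint.mono_set (hsub hT hu))]
      exact intervalIntegral.integral_nonneg_of_forall hu.2
        fun w => mul_nonneg (Real.exp_pos _).le ENNReal.toReal_nonneg
    have hcn : 0 ≤ c := mul_nonneg (indicator_nonneg (fun _ _ => zero_le_one) x) (Real.exp_pos _).le
    rw [ConsQFun.PbarR, Q.aux_Pbar_eq t hB, e0, e1, ← ENNReal.ofReal_add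
      (mul_nonneg (Real.exp_pos _).le hcn) (mul_nonneg (Real.exp_pos _).le hGn),
      ENNReal.toReal_ofReal (by positivity), hF]
    ring
  have hconst : ∀ k : ℝ, AbsolutelyContinuousOnInterval (fun _ : ℝ => k) T₀ t := fun k =>
    (LipschitzWith.const k).lipschitzOnWith.absolutelyContinuousOnInterval
  have hFac : AbsolutelyContinuousOnInterval F T₀ t :=
    (ConsQFun.aux_ac_exp hAac).fun_mul ((hconst c).fun_add ((hconst (G t)).fun_sub hGac))
  have hFt : F t = B.indicator (fun _ => (1 : ℝ)) x := by
    simp only [hF, hc]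
    rw [sub_self, add_zero, mul_comm, mul_assoc, ← Real.exp_add]
    simp
  refine ⟨⟨?_, ?_⟩, ?_⟩
  · have hcont := hFac.continuousOn t right_mem_uIcc
    rw [ContinuousWithinAt, hFt, uIcc_of_le ht₀.le] at hcont
    have h1 : Tendsto F (𝓝[<] t) (𝓝 (B.indicator (fun _ => (1 : ℝ)) x)) := by
      rw [← nhdsWithin_Ico_eq_nhdsLT ht₀]
      exact hcont.mono_left (nhdsWithin_mono _ Ico_subset_Icc_self)
    refine h1.congr' ?_
    filter_upwards [Ico_mem_nhdsLT ht₀] with u hu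
    exact (hform u (Ico_subset_Icc_self hu)).symm
  · have h1 := aux_absCont ht₀.le hFac
    intro ε hε
    obtain ⟨δ, hδ, h2⟩ := h1 ε hε
    refine ⟨δ, hδ, fun n a b h3 h4 h5 => ?_⟩
    refine lt_of_eq_of_lt (Finset.sum_congr rfl fun i hi => ?_) (h2 n a b h3 h4 h5)
    have h6 := h3 i (Finset.mem_range.1 hi)
    beta_reduce
    rw [hform _ (Ico_subset_Icc_self h6.1), hform _ (Ico_subset_Icc_self h6.2.1)]
  · rw [ae_restrict_iff' measurableSet_Ico]
    have hne : ∀ᵐ u : ℝ, u ≠ T₀ := by simp [ae_iff, measure_singleton]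
    filter_upwards [hq.ae_hasDerivAt_integral, hhint.ae_hasDerivAt_integral, hne]
      with u h1 h2 h3 hu
    have hu' : u ∈ uIcc T₀ t := by rw [uIcc_of_le ht₀.le]; exact Ico_subset_Icc_self hu
    have hd1 : HasDerivAt A (Q.qrate x u) u := h1 hu' T₀ left_mem_uIcc
    have hd2 : HasDerivAt G (h u) u := h2 hu' T₀ left_mem_uIcc
    have hd := hd1.exp.fun_mul ((hd2.const_sub (G t)).const_add c)
    have hev : (fun v => Q.PbarR v x t B) =ᶠ[𝓝 u] F := by
      filter_upwards [Ioo_mem_nhds (lt_of_le_of_ne hu.1 (Ne.symm h3)) hu.2] with v hv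
      exact hform v (Ioo_subset_Icc_self hv)
    have hIg : ∫ y, Q.PbarR u y t B ∂(Q.qp x u) = g u := by
      refine integral_toReal ?_ ?_
      · exact ((Q.aux_meas_Pbar t hB).comp
          (by fun_prop : Measurable fun y : X => (u, y))).aemeasurable
      · exact Eventually.of_forall fun y =>
          (Q.aux_le_one hL1 ht₀ ht₁ hB hu.1 hu.2.le y).trans_lt ENNReal.one_lt_top
    refine (HasDerivAt.congr_of_eventuallyEq ?_ hev)
    rw [hIg, hform u (Ico_subset_Icc_self hu)]
    refine HasDerivAt.congr_deriv hd ?_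
    symm
    show Q.qrate x u * (Real.exp (A u) * (c + (G t - G u))) - g u =
      Real.exp (A u) * Q.qrate x u * (c + (G t - G u)) +
        Real.exp (A u) * (-(Real.exp (-(A u)) * g u))
    have : Real.exp (A u) * Real.exp (-(A u)) = 1 := by rw [← Real.exp_add]; simp
    linear_combination (g u) * this
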